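/- arXiv:2503.03159 — 3 statements merged into one kernel-verified Lean document; each statement's English description precedes it below -/
import Mathlib

section
/- Every primorial greater than 30 satisfies Robin's inequality; that is, if m is a product of the first k primes for some k and m > 30, then σ(m) < e^γ · m · log(log m). -/
open Real

/-- Robin's inequality for `n`: `σ(n) < e^γ · n · log(log n)`. -/
def RobinInequality (n : ℕ) : Prop :=
  (ArithmeticFunction.sigma 1 n : ℝ) <
    Real.exp Real.eulerMascheroniConstant * n * Real.log (Real.log n)

open Chebyshev Finset

lemma log_le_of_pow_le {x : ℝ} (hx : 0 < x) {a b : ℕ} (hb : 0 < b)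
    (h : x ^ b ≤ 2.7182818283 ^ a) : log x ≤ a / b := by
  have hb' : (0 : ℝ) < b := by exact_mod_cast hb
  rw [le_div_iff₀ hb', mul_comm, ← Real.log_pow, Real.log_le_iff_le_exp (by positivity),
    ← Real.exp_one_pow]
  exact h.trans (pow_le_pow_left₀ (by norm_num) Real.exp_one_gt_d9.le _)

lemma le_log_of_pow_le {x : ℝ} (hx : 0 < x) {a b : ℕ} (hb : 0 < b)
    (h : 2.7182818286 ^ a ≤ x ^ b) : a / b ≤ log x := by
  have hb' : (0 : ℝ) < b := by exact_mod_cast hb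
  rw [div_le_iff₀ hb', mul_comm, ← Real.log_pow, Real.le_log_iff_exp_le (by positivity),
    ← Real.exp_one_pow]
  exact (pow_le_pow_left₀ (Real.exp_pos _).le Real.exp_one_lt_d9.le _).trans h

/-- The product of `1 + 1 / p` over the primes `p ≤ n`. -/
noncomputable def primeProd (n : ℕ) : ℝ := ∏ p ∈ Nat.primesLE n, (1 + 1 / (p : ℝ))

/-- The sum of `log p / p` over the primes `p ≤ n`. -/
noncomputable def logPrimeSum (n : ℕ) : ℝ := ∑ p ∈ Nat.primesLE n, log p / p

lemma primeProd_pos (n : ℕ) : 0 < primeProd n := prod_pos fun _ _ ↦ by positivity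

lemma primeProd_mono : Monotone primeProd := fun _ _ h ↦
  prod_le_prod_of_subset_of_one_le (Nat.primesLE_mono h) (fun _ _ ↦ by positivity)
    fun _ _ _ ↦ le_add_of_nonneg_right (by positivity)

lemma theta_natCast_eq_log_primorial (n : ℕ) : θ n = log (primorial n) := by
  rw [theta_eq_log_primorial, Nat.floor_natCast]

lemma log_factorial_le {n : ℕ} (hn : 1 ≤ n) :
    log (n.factorial : ℝ) ≤ (n + 1) * log n - n + 1 := by
  induction n, hn using Nat.le_induction with
  | base => simp
  | succ n hn ih =>
    have h0 : (0 : ℝ) < n := by exact_mod_cast hn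
    have h1 : 1 - ((n + 1 : ℝ) / n)⁻¹ ≤ log ((n + 1 : ℝ) / n) :=
      Real.one_sub_inv_le_log_of_pos (by positivity)
    rw [Real.log_div (by positivity) (by positivity)] at h1
    have h2 : 1 ≤ (n + 1 : ℝ) * (log (n + 1) - log n) := by
      calc (1 : ℝ) = (n + 1) * (1 - ((n + 1 : ℝ) / n)⁻¹) := by field_simp; ring
        _ ≤ _ := by gcongr
    rw [Nat.factorial_succ]
    push_cast
    rw [Real.log_mul (by positivity) (by positivity)]
    linarith

lemma pow_dvd_factorial_mul {p : ℕ} (hp : 0 < p) (k : ℕ) : p ^ k ∣ (p * k).factorial := by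
  induction k with
  | zero => simp
  | succ k ih =>
    obtain ⟨q, rfl⟩ := Nat.exists_eq_add_of_lt hp
    rw [pow_succ', Nat.mul_succ, ← Nat.add_assoc _ (0 + q) 1, Nat.factorial_succ]
    exact mul_dvd_mul ⟨k + 1, by ring⟩
      (ih.trans (Nat.factorial_dvd_factorial (Nat.le_add_right _ _)))

lemma prod_primesLE_pow_div_dvd_factorial (x n : ℕ) :
    ∏ p ∈ Nat.primesLE x, p ^ (n / p) ∣ n.factorial := by
  refine Finset.prod_dvd_of_isRelPrime (fun p hp q hq hpq ↦ ?_) fun p hp ↦ ?_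
  · exact Nat.coprime_iff_isRelPrime.1 (((Nat.coprime_primes (Nat.prime_of_mem_primesLE hp)
      (Nat.prime_of_mem_primesLE hq)).2 hpq).pow _ _)
  · exact (pow_dvd_factorial_mul (Nat.prime_of_mem_primesLE hp).pos _).trans
      (Nat.factorial_dvd_factorial (Nat.mul_div_le n p))

lemma sum_div_mul_log_le (x n : ℕ) :
    ∑ p ∈ Nat.primesLE x, ((n / p : ℕ) : ℝ) * log p ≤ log n.factorial := by
  have h := Nat.le_of_dvd n.factorial_pos (prod_primesLE_pow_div_dvd_factorial x n)
  have h' : (∏ p ∈ Nat.primesLE x, (p : ℝ) ^ (n / p)) ≤ n.factorial := by exact_mod_cast h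
  have hpos : ∀ p ∈ Nat.primesLE x, (0 : ℝ) < (p : ℝ) ^ (n / p) := fun p hp ↦ by
    have := (Nat.prime_of_mem_primesLE hp).pos
    positivity
  have := Real.log_le_log (prod_pos hpos) h'
  rw [Real.log_prod fun p hp ↦ (hpos p hp).ne'] at this
  simpa only [Real.log_pow] using this

lemma succ_mul_logPrimeSum_le (x n : ℕ) :
    (n + 1) * logPrimeSum x ≤ θ x + log n.factorial := by
  refine le_trans ?_ (add_le_add_right (sum_div_mul_log_le x n) _)
  rw [theta_eq_sum_primesLE_log, logPrimeSum, mul_sum, ← sum_add_distrib]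
  refine sum_le_sum fun p hp ↦ ?_
  have hp0 : (0 : ℝ) < p := by exact_mod_cast (Nat.prime_of_mem_primesLE hp).pos
  have hlog : 0 ≤ log (p : ℝ) := Real.log_natCast_nonneg p
  have h1 : (n + 1 : ℝ) ≤ p * ((n / p : ℕ) + 1) := by
    exact_mod_cast Nat.lt_mul_div_succ n (Nat.prime_of_mem_primesLE hp).pos
  calc (n + 1) * (log p / p) = (n + 1 : ℝ) / p * log p := by ring
    _ ≤ ((n / p : ℕ) + 1) * log p := by
        gcongr
        rwa [div_le_iff₀ hp0, mul_comm]
    _ = _ := by ring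

/-- An upper bound of Mertens type in terms of `θ x`. -/
lemma logPrimeSum_le {x : ℕ} (hx : 1 ≤ θ x) : logPrimeSum x ≤ log (θ x) + 2 / θ x := by
  set n := ⌊θ x⌋₊
  have hn1 : 1 ≤ n := Nat.one_le_floor_iff _ |>.2 hx
  have hn0 : (0 : ℝ) < n := by exact_mod_cast hn1
  have hle : (n : ℝ) ≤ θ x := Nat.floor_le (by linarith)
  have hlt : θ x < n + 1 := Nat.lt_floor_add_one _
  have h1 := succ_mul_logPrimeSum_le x n
  have h2 := log_factorial_le hn1
  have h3 : log (n : ℝ) ≤ log (θ x) := Real.log_le_log hn0 hle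
  have h4 : (n + 1 : ℝ) * logPrimeSum x ≤ (n + 1) * log (θ x) + 2 := by nlinarith
  have h5 : logPrimeSum x ≤ log (θ x) + 2 / (n + 1) := by
    rw [← sub_le_iff_le_add', le_div_iff₀ (by positivity)]
    linarith
  refine h5.trans ?_
  gcongr

lemma four_le_log {t : ℝ} (ht : 80 ≤ t) : 4 ≤ log t := by
  calc (4 : ℝ) = (4 : ℕ) / (1 : ℕ) := by norm_num
    _ ≤ log 80 := le_log_of_pow_le (by norm_num) (by norm_num) (by norm_num)
    _ ≤ _ := Real.log_le_log (by norm_num) ht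

lemma logPrimeSum_le_log_theta_add {n : ℕ} (hθ : 80 ≤ θ n) :
    logPrimeSum n ≤ log (θ n) + 1 / 40 := by
  have : 2 / θ n ≤ 1 / 40 := by
    rw [div_le_div_iff₀ (by linarith) (by norm_num)]
    linarith
  linarith [logPrimeSum_le (x := n) (by linarith)]

/-- A function of `n`, nonincreasing for large `n`, bounding `log (primeProd n / log (θ n))`. -/
noncomputable def robinPotential (n : ℕ) : ℝ :=
  log (primeProd n) + (log (θ n) + 1 / 40 - logPrimeSum n) / (log (θ n) - 1 / 3)
    - log (log (θ n) - 1 / 3)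

lemma log_theta_le {n : ℕ} (hn : 2 ≤ n) : log (θ n) ≤ log n + 1 / 3 := by
  have hn0 : (0 : ℝ) < n := by positivity
  have h4 : log 4 ≠ 0 := by positivity
  have h : log (log 4) ≤ 1 / 3 := by
    have h2 : log 4 ≤ 1.3863 := by
      rw [show (4 : ℝ) = 2 ^ 2 by norm_num, Real.log_pow]
      have := Real.log_two_lt_d9
      norm_num at this ⊢
      linarith
    calc log (log 4) ≤ log 1.3863 := Real.log_le_log (by positivity) h2
      _ ≤ (1 : ℕ) / (3 : ℕ) := log_le_of_pow_le (by norm_num) (by norm_num) (by norm_num)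
      _ = 1 / 3 := by norm_num
  calc log (θ n) ≤ log (log 4 * n) :=
        Real.log_le_log (theta_pos (by exact_mod_cast hn)) (theta_le_log4_mul_x hn0.le)
    _ = log (log 4) + log n := Real.log_mul h4 hn0.ne'
    _ ≤ _ := by linarith

lemma robinPotential_succ_le {n : ℕ} (hθ : 80 ≤ θ n) :
    robinPotential (n + 1) ≤ robinPotential n := by
  by_cases hp : (n + 1).Prime
  swap
  · have h : Nat.primesLE (n + 1) = Nat.primesLE n := by simp [Nat.primesLE_succ, hp]
    simp only [robinPotential, primeProd, logPrimeSum, theta_eq_sum_primesLE_log, h, le_refl]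
  have h : Nat.primesLE (n + 1) = insert (n + 1) (Nat.primesLE n) := by
    simp [Nat.primesLE_succ, hp]
  have hp2 : (2 : ℝ) ≤ (n + 1 : ℕ) := by exact_mod_cast hp.two_le
  have hS := Real.log_le_sub_one_of_pos (x := 1 + 1 / ((n + 1 : ℕ) : ℝ)) (by positivity)
  have hR : log (primeProd (n + 1)) =
      log (1 + 1 / ((n + 1 : ℕ) : ℝ)) + log (primeProd n) := by
    rw [← Real.log_mul (by positivity) (primeProd_pos n).ne', primeProd, h,
      prod_insert (Nat.notMem_primesLE n), primeProd]
  have hA : logPrimeSum (n + 1) = log (n + 1 : ℕ) / (n + 1 : ℕ) + logPrimeSum n := by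
    rw [logPrimeSum, h, sum_insert (Nat.notMem_primesLE n), logPrimeSum]
  have hT : log (θ n) ≤ log (θ (n + 1 : ℕ)) :=
    Real.log_le_log (by linarith) (theta_mono (by push_cast; linarith))
  have hU := log_theta_le hp.two_le
  have hL := four_le_log hθ
  have hD := logPrimeSum_le_log_theta_add hθ
  simp only [robinPotential]
  rw [hR, hA]
  generalize ((n + 1 : ℕ) : ℝ) = p at *
  generalize log (θ n) = a at *
  generalize log (θ p) = b at *
  have ha : 0 < a - 1 / 3 := by linarith
  have hb : 0 < b - 1 / 3 := by linarith
  have hlogy := Real.one_sub_inv_le_log_of_pos (div_pos hb ha)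
  rw [Real.log_div hb.ne' ha.ne', inv_div] at hlogy
  have hinv : (b - 1 / 3)⁻¹ ≤ (a - 1 / 3)⁻¹ := inv_anti₀ ha (by linarith)
  have hmono : (a + 1 / 40 - logPrimeSum n) * (b - 1 / 3)⁻¹ ≤
      (a + 1 / 40 - logPrimeSum n) * (a - 1 / 3)⁻¹ :=
    mul_le_mul_of_nonneg_left hinv (by linarith)
  have hstep : 1 / p ≤ log p / p * (b - 1 / 3)⁻¹ := by
    rw [← div_eq_mul_inv, div_div, div_le_div_iff₀ (by positivity) (by positivity)]
    nlinarith
  have hsplit : (b + 1 / 40 - (log p / p + logPrimeSum n)) / (b - 1 / 3) =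
      (a + 1 / 40 - logPrimeSum n) * (b - 1 / 3)⁻¹ - log p / p * (b - 1 / 3)⁻¹
        + (1 - (a - 1 / 3) / (b - 1 / 3)) := by
    rw [div_eq_mul_inv _ (b - 1 / 3), div_eq_mul_inv _ (b - 1 / 3)]
    linear_combination mul_inv_cancel₀ hb.ne'
  rw [hsplit, div_eq_mul_inv (a + 1 / 40 - logPrimeSum n)]
  linarith

lemma primeProd_le_of_rat {n : ℕ} {r : ℚ}
    (h : ∏ p ∈ Nat.primesLE n, (1 + 1 / (p : ℚ)) ≤ r) : primeProd n ≤ r := by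
  simpa [primeProd] using (Rat.cast_le (K := ℝ)).2 h

lemma logPrimeSum_113 : 3.49 ≤ logPrimeSum 113 := by
  have hq : 30.22 ≤ ∑ p ∈ Nat.primesLE 113, (Nat.log 2 (p ^ 6) : ℚ) / p := by
    decide +kernel
  have hr : 30.22 ≤ ∑ p ∈ Nat.primesLE 113, (Nat.log 2 (p ^ 6) : ℝ) / p := by
    have := (Rat.cast_le (K := ℝ)).2 hq
    push_cast at this
    norm_num at this ⊢
    exact this
  have h : (∑ p ∈ Nat.primesLE 113, (Nat.log 2 (p ^ 6) : ℝ) / p) * (log 2 / 6) ≤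
      logPrimeSum 113 := by
    rw [logPrimeSum, sum_mul]
    refine sum_le_sum fun p hp ↦ ?_
    have hp0 := (Nat.prime_of_mem_primesLE hp).pos
    have h1 : ((2 : ℝ) ^ Nat.log 2 (p ^ 6)) ≤ (p : ℝ) ^ 6 := by
      exact_mod_cast Nat.pow_log_le_self 2 (by positivity)
    have h2 := Real.log_le_log (by positivity) h1
    rw [Real.log_pow, Real.log_pow] at h2
    rw [div_mul_eq_mul_div]
    gcongr
    push_cast at h2
    linarith
  have := Real.log_two_gt_d9
  norm_num at this hr ⊢
  nlinarith

lemma theta_113_bounds : 106.7 ≤ θ (113 : ℕ) ∧ θ (113 : ℕ) ≤ 107.5 := by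
  have hlo : 2 ^ 154 ≤ primorial 113 := by decide +kernel
  have hhi : primorial 113 ≤ 2 ^ 155 := by decide +kernel
  have hpos : (0 : ℝ) < primorial 113 := by exact_mod_cast primorial_pos 113
  have h1 : 154 * log 2 ≤ log (primorial 113) := by
    rw [← Real.log_rpow (by norm_num)]
    exact Real.log_le_log (by positivity) (by exact_mod_cast hlo)
  have h2 : log (primorial 113) ≤ 155 * log 2 := by
    rw [← Real.log_rpow (by norm_num)]
    exact Real.log_le_log hpos (by exact_mod_cast hhi)
  have h3 := Real.log_two_gt_d9
  have h4 := Real.log_two_lt_d9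
  rw [theta_natCast_eq_log_primorial]
  generalize log (primorial 113 : ℝ) = t at *
  norm_num at h3 h4 ⊢
  constructor <;> linarith

lemma primeProd_113 : primeProd 113 ≤ 5.305 :=
  (primeProd_le_of_rat (r := 5.305) (by decide +kernel)).trans (by norm_num)

lemma robinPotential_113_le : robinPotential 113 ≤ 1 / 2 := by
  obtain ⟨hlo, hhi⟩ := theta_113_bounds
  have hS : log (primeProd 113) ≤ 1.67 := by
    calc log (primeProd 113) ≤ log 5.305 := Real.log_le_log (primeProd_pos _) primeProd_113
      _ ≤ (167 : ℕ) / (100 : ℕ) := log_le_of_pow_le (by norm_num) (by norm_num) (by norm_num)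
      _ = 1.67 := by norm_num
  have hL1 : log (θ (113 : ℕ)) ≤ 4.68 := by
    calc log (θ (113 : ℕ)) ≤ log 107.5 :=
        Real.log_le_log (lt_of_lt_of_le (by norm_num) hlo) hhi
      _ ≤ (117 : ℕ) / (25 : ℕ) := log_le_of_pow_le (by norm_num) (by norm_num) (by norm_num)
      _ = 4.68 := by norm_num
  have hL2 : 14 / 3 ≤ log (θ (113 : ℕ)) := by
    calc (14 / 3 : ℝ) = (14 : ℕ) / (3 : ℕ) := by norm_num
      _ ≤ log 106.7 := le_log_of_pow_le (by norm_num) (by norm_num) (by norm_num)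
      _ ≤ _ := Real.log_le_log (by norm_num) hlo
  have hA := logPrimeSum_113
  rw [robinPotential]
  generalize log (θ (113 : ℕ)) = a at *
  have hll : 1.464 ≤ log (a - 1 / 3) := by
    calc (1.464 : ℝ) = (183 : ℕ) / (125 : ℕ) := by norm_num
      _ ≤ log 4.333 := le_log_of_pow_le (by norm_num) (by norm_num) (by norm_num)
      _ ≤ _ := Real.log_le_log (by norm_num) (by norm_num at hL2 ⊢; linarith)
  have hq : (a + 1 / 40 - logPrimeSum 113) / (a - 1 / 3) ≤ 0.28 := by
    rw [div_le_iff₀ (by norm_num at hL2 ⊢; linarith)]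
    norm_num at *
    linarith
  norm_num at *
  linarith

lemma exp_eulerMascheroniConstant_gt : 1.648 < exp eulerMascheroniConstant := by
  have h1 : (1.648 : ℝ) ≤ exp (1 / 2) := by
    refine le_of_sq_le_sq ?_ (exp_pos _).le
    rw [← Real.exp_nat_mul]
    have := Real.exp_one_gt_d9
    norm_num at this ⊢
    linarith
  exact h1.trans_lt (Real.exp_lt_exp.2 one_half_lt_eulerMascheroniConstant)

lemma primeProd_lt_of_ge {n : ℕ} (hn : 113 ≤ n) :
    primeProd n < exp eulerMascheroniConstant * log (θ n) := by
  have hθ : ∀ k : ℕ, 113 ≤ k → 106.7 ≤ θ k := fun k hk ↦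
    theta_113_bounds.1.trans (theta_mono (by exact_mod_cast hk))
  have hP : robinPotential n ≤ 1 / 2 := by
    induction n, hn using Nat.le_induction with
    | base => exact robinPotential_113_le
    | succ k hk ih =>
      exact (robinPotential_succ_le (le_trans (by norm_num) (hθ k hk))).trans ih
  have h80 : 80 ≤ θ n := le_trans (by norm_num) (hθ n hn)
  have hL := four_le_log h80
  have hD := logPrimeSum_le_log_theta_add h80
  have hnn : 0 ≤ (log (θ n) + 1 / 40 - logPrimeSum n) / (log (θ n) - 1 / 3) :=
    div_nonneg (by linarith) (by linarith)
  have hll : log (log (θ n) - 1 / 3) ≤ log (log (θ n)) :=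
    Real.log_le_log (by linarith) (by linarith)
  rw [robinPotential] at hP
  have hγ := one_half_lt_eulerMascheroniConstant
  rw [← Real.log_lt_log_iff (primeProd_pos n) (by positivity),
    Real.log_mul (by positivity) (by positivity), Real.log_exp]
  linarith

lemma primeProd_lt_of_mem_Icc {a b n : ℕ} (han : a ≤ n) (hnb : n ≤ b) {t l : ℝ} {r : ℚ}
    (ht : 0 < t) (hθ : t ≤ log (primorial a)) (hl : l ≤ log t)
    (hr : ∏ p ∈ Nat.primesLE b, (1 + 1 / (p : ℚ)) ≤ r) (hl0 : 0 < l) (hrl : r ≤ 1.648 * l) :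
    primeProd n < exp eulerMascheroniConstant * log (θ n) := by
  have h1 : l ≤ log (θ n) := by
    refine hl.trans (Real.log_le_log ht (hθ.trans ?_))
    rw [← theta_natCast_eq_log_primorial]
    exact theta_mono (by exact_mod_cast han)
  calc primeProd n ≤ primeProd b := primeProd_mono hnb
    _ ≤ r := primeProd_le_of_rat hr
    _ ≤ 1.648 * l := hrl
    _ < exp eulerMascheroniConstant * l := by
      gcongr
      exact exp_eulerMascheroniConstant_gt
    _ ≤ _ := by gcongr

lemma primeProd_lt {n : ℕ} (hn : 7 ≤ n) :
    primeProd n < exp eulerMascheroniConstant * log (θ n) := by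
  have key : ∀ {x : ℝ} {a b : ℕ} (y : ℝ), 0 < x → 0 < b → y = a / b →
      2.7182818286 ^ a ≤ x ^ b → y ≤ log x := fun y hx hb hy h ↦ hy ▸ le_log_of_pow_le hx hb h
  rcases le_or_gt 113 n with h | h
  · exact primeProd_lt_of_ge h
  rcases le_or_gt 37 n with h37 | h37
  · refine primeProd_lt_of_mem_Icc h37 h.le (t := 28) (l := 3.25) (r := 5.305) (by norm_num) ?_
      (key (a := 13) (b := 4) _ (by norm_num) (by norm_num) (by norm_num) (by norm_num))
      (by decide +kernel) (by norm_num) (by norm_num)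
    rw [show primorial 37 = 7420738134810 by decide +kernel]
    exact key (a := 28) (b := 1) _ (by norm_num) (by norm_num) (by norm_num) (by norm_num)
  rcases le_or_gt 17 n with h17 | h17
  · refine primeProd_lt_of_mem_Icc h17 (Nat.le_of_lt_succ h37) (t := 13) (l := 2.5) (r := 4.1)
      (by norm_num) ?_
      (key (a := 5) (b := 2) _ (by norm_num) (by norm_num) (by norm_num) (by norm_num))
      (by decide +kernel) (by norm_num) (by norm_num)
    rw [show primorial 17 = 510510 by decide +kernel]
    exact key (a := 13) (b := 1) _ (by norm_num) (by norm_num) (by norm_num) (by norm_num)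
  rcases le_or_gt 11 n with h11 | h11
  · refine primeProd_lt_of_mem_Icc h11 (Nat.le_of_lt_succ h17) (t := 7.7) (l := 2) (r := 3.25)
      (by norm_num) ?_
      (key (a := 2) (b := 1) _ (by norm_num) (by norm_num) (by norm_num) (by norm_num))
      (by decide +kernel) (by norm_num) (by norm_num)
    rw [show primorial 11 = 2310 by decide +kernel]
    exact key (a := 77) (b := 10) _ (by norm_num) (by norm_num) (by norm_num) (by norm_num)
  · refine primeProd_lt_of_mem_Icc hn (Nat.le_of_lt_succ h11) (t := 5.3) (l := 5 / 3)
      (r := 2.743) (by norm_num) ?_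
      (key (a := 5) (b := 3) _ (by norm_num) (by norm_num) (by norm_num) (by norm_num))
      (by decide +kernel) (by norm_num) (by norm_num)
    rw [show primorial 7 = 210 by decide +kernel]
    exact key (a := 53) (b := 10) _ (by norm_num) (by norm_num) (by norm_num) (by norm_num)

lemma sigma_one_primorial (n : ℕ) :
    (ArithmeticFunction.sigma 1 (primorial n) : ℝ) = primorial n * primeProd n := by
  rw [primorial_eq_prod_primesLE,
    ArithmeticFunction.isMultiplicative_sigma.map_prod_of_prime _
      fun p hp ↦ Nat.prime_of_mem_primesLE hp, primeProd]
  push_cast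
  rw [← prod_mul_distrib]
  refine prod_congr rfl fun p hp ↦ ?_
  have hp' := Nat.prime_of_mem_primesLE hp
  have hp0 : (p : ℝ) ≠ 0 := by exact_mod_cast hp'.ne_zero
  rw [ArithmeticFunction.sigma_one_apply, hp'.divisors, sum_pair hp'.one_lt.ne]
  push_cast
  field_simp
  ring

lemma prod_range_succ_nth_prime (k : ℕ) :
    ∏ i ∈ range (k + 1), Nat.nth Nat.Prime i = primorial (Nat.nth Nat.Prime k) := by
  have hinf := Nat.infinite_setOfPred_prime
  rw [primorial_eq_prod_primesLE]
  have h : Nat.primesLE (Nat.nth Nat.Prime k) = (range (k + 1)).image (Nat.nth Nat.Prime) := by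
    ext p
    simp only [Nat.mem_primesLE, mem_image, mem_range, Nat.lt_succ_iff]
    constructor
    · rintro ⟨hle, hp⟩
      refine ⟨Nat.count Nat.Prime p, ?_, Nat.nth_count hp⟩
      rwa [← Nat.nth_le_nth hinf, Nat.nth_count hp]
    · rintro ⟨i, hi, rfl⟩
      exact ⟨(Nat.nth_le_nth hinf).2 hi, Nat.prime_nth_prime i⟩
  rw [h, prod_image fun _ _ _ _ hij ↦ Nat.nth_injective hinf hij]

/-- Every primorial greater than `30` satisfies Robin's inequality. -/
theorem robin_primorial (m : ℕ)
    (hm : ∃ k : ℕ, m = ∏ i ∈ Finset.range k, Nat.nth Nat.Prime i)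
    (h : 30 < m) : RobinInequality m := by
  obtain ⟨_ | k, rfl⟩ := hm
  · simp at h
  rw [prod_range_succ_nth_prime] at h ⊢
  generalize Nat.nth Nat.Prime k = n at h
  have hn : 7 ≤ n := by
    by_contra! hlt
    have h6 : primorial 6 = 30 := by decide +kernel
    exact absurd (primorial_mono (Nat.le_of_lt_succ hlt)) (by omega)
  have hpos : (0 : ℝ) < primorial n := by exact_mod_cast primorial_pos n
  rw [RobinInequality, sigma_one_primorial, ← theta_natCast_eq_log_primorial]
  calc (primorial n : ℝ) * primeProd n
      < primorial n * (exp eulerMascheroniConstant * log (θ n)) := by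
        gcongr
        exact primeProd_lt hn
    _ = _ := by ring
end

section
/- For every real number x ≥ 4, H(x) < 2·log(x)/(1 + 6/(π²·x)). -/
open Real

/-- The continuous interpolation `H(x) = ∫₀¹ (tˣ − 1)/(t − 1) dt` of the
harmonic numbers. -/
noncomputable def harmonicInterp (x : ℝ) : ℝ :=
  ∫ t in (0 : ℝ)..1, (t ^ x - 1) / (t - 1)

lemma rpow_sub_one_div_nonneg {x t : ℝ} (hx : 0 ≤ x) (ht : t ∈ Set.Icc (0 : ℝ) 1) :
    0 ≤ (t ^ x - 1) / (t - 1) :=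
  div_nonneg_of_nonpos (sub_nonpos.2 (rpow_le_one ht.1 ht.2 hx)) (sub_nonpos.2 ht.2)

lemma rpow_sub_one_div_le {x t : ℝ} (hx : 1 ≤ x) (ht : t ∈ Set.Icc (0 : ℝ) 1) :
    (t ^ x - 1) / (t - 1) ≤ x := by
  rcases ht.2.eq_or_lt with rfl | h
  · simp only [sub_self, div_zero]
    linarith
  · rw [div_le_iff_of_neg (by linarith)]
    have hb := one_add_mul_self_le_rpow_one_add (s := t - 1) (by linarith [ht.1]) hx
    rw [add_sub_cancel] at hb
    linarith

lemma rpow_sub_one_div_le_one_div {x t : ℝ} (h₀ : 0 ≤ t) (h₁ : t < 1) :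
    (t ^ x - 1) / (t - 1) ≤ 1 / (1 - t) := by
  rw [← neg_div_neg_eq, neg_sub, neg_sub]
  have := rpow_nonneg h₀ x
  have : 0 < 1 - t := by linarith
  gcongr
  linarith

lemma intervalIntegrable_rpow_sub_one_div {x a b : ℝ} (hx : 1 ≤ x)
    (ha : 0 ≤ a) (hab : a ≤ b) (hb : b ≤ 1) :
    IntervalIntegrable (fun t : ℝ ↦ (t ^ x - 1) / (t - 1)) MeasureTheory.volume a b := by
  refine (intervalIntegrable_const (c := x)).mono_fun' ?_ ?_
  · exact (by fun_prop : Measurable fun t : ℝ ↦ (t ^ x - 1) / (t - 1)).aestronglyMeasurable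
  · rw [Set.uIoc_of_le hab]
    filter_upwards [MeasureTheory.ae_restrict_mem measurableSet_Ioc] with t ht
    have ht' : t ∈ Set.Icc (0 : ℝ) 1 := ⟨ha.trans ht.1.le, ht.2.trans hb⟩
    rw [Real.norm_of_nonneg (rpow_sub_one_div_nonneg (by linarith) ht')]
    exact rpow_sub_one_div_le hx ht'

lemma harmonicInterp_le_one_add_log {x : ℝ} (hx : 1 ≤ x) :
    harmonicInterp x ≤ 1 + Real.log x := by
  have hx0 : 0 < x := by linarith
  have hi0 : 0 < x⁻¹ := inv_pos.2 hx0
  have hi1 : x⁻¹ ≤ 1 := inv_le_one_of_one_le₀ hx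
  have ha0 : 0 ≤ 1 - x⁻¹ := by linarith
  have ha1 : 1 - x⁻¹ ≤ 1 := by linarith
  have hleft := intervalIntegrable_rpow_sub_one_div hx le_rfl ha0 ha1
  have hright := intervalIntegrable_rpow_sub_one_div hx ha0 ha1 le_rfl
  have hlog : ∫ t in (0 : ℝ)..(1 - x⁻¹), 1 / (1 - t) = Real.log x := by
    rw [intervalIntegral.integral_comp_sub_left (fun t : ℝ ↦ 1 / t), sub_sub_cancel, sub_zero,
      integral_one_div_of_pos hi0 one_pos, one_div, inv_inv]
  have hint : IntervalIntegrable (fun t : ℝ ↦ 1 / (1 - t)) MeasureTheory.volume 0 (1 - x⁻¹) := by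
    refine ContinuousOn.intervalIntegrable_of_Icc ha0 ?_
    refine continuousOn_const.div (by fun_prop) fun t ht ↦ ?_
    linarith [ht.2]
  have h₁ : ∫ t in (0 : ℝ)..(1 - x⁻¹), (t ^ x - 1) / (t - 1) ≤ Real.log x := by
    rw [← hlog]
    exact intervalIntegral.integral_mono_on ha0 hleft hint fun t ht ↦
      rpow_sub_one_div_le_one_div ht.1 (by linarith [ht.2])
  have h₂ : ∫ t in (1 - x⁻¹)..(1 : ℝ), (t ^ x - 1) / (t - 1) ≤ 1 := by
    calc _ ≤ ∫ _ in (1 - x⁻¹)..(1 : ℝ), x :=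
          intervalIntegral.integral_mono_on ha1 hright intervalIntegrable_const fun t ht ↦
            rpow_sub_one_div_le hx ⟨ha0.trans ht.1, ht.2⟩
      _ = 1 := by
          rw [intervalIntegral.integral_const, sub_sub_cancel, smul_eq_mul,
            inv_mul_cancel₀ hx0.ne']
  rw [harmonicInterp, ← intervalIntegral.integral_add_adjacent_intervals hleft hright]
  linarith

/-- For every real `x ≥ 4`, `H(x) < 2·log(x)/(1 + 6/(π²·x))`. -/
theorem harmonicInterp_lt' (x : ℝ) (hx : 4 ≤ x) :
    harmonicInterp x < 2 * Real.log x / (1 + 6 / (Real.pi ^ 2 * x)) := by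
  refine (harmonicInterp_le_one_add_log (by linarith)).trans_lt ?_
  have hlog : 1.386 ≤ Real.log x := by
    have h4 : Real.log 4 = 2 * Real.log 2 := by
      rw [show (4 : ℝ) = 2 ^ 2 by norm_num, Real.log_pow]
      norm_num
    have := Real.log_le_log (by norm_num) hx
    linarith [Real.log_two_gt_d9]
  have hpi : (9.859 : ℝ) ≤ Real.pi ^ 2 := by nlinarith [Real.pi_gt_d2]
  have hc : 6 / (Real.pi ^ 2 * x) ≤ 0.1522 := by
    rw [div_le_iff₀ (by positivity)]
    nlinarith
  have hc0 : 0 < 6 / (Real.pi ^ 2 * x) := by positivity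
  rw [lt_div_iff₀ (by linarith)]
  nlinarith
end

section
/- For every real number x ≥ 4, the derivative of H satisfies H′(x) > H(x)·log(H(x))/x². -/
open Real

theorem rpow_mul_log_div_sub_one_nonneg {t : ℝ} (ht : t ∈ Set.Ioc (0 : ℝ) 1) (x : ℝ) :
    0 ≤ t ^ x * log t / (t - 1) :=
  div_nonneg_of_nonpos
    (mul_nonpos_of_nonneg_of_nonpos (rpow_nonneg ht.1.le x) (log_nonpos ht.1.le ht.2))
    (sub_nonpos.2 ht.2)

theorem rpow_le_rpow_mul_log_div_sub_one {t : ℝ} (ht : t ∈ Set.Ioo (0 : ℝ) 1) (x : ℝ) :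
    t ^ x ≤ t ^ x * log t / (t - 1) := by
  rw [le_div_iff_of_neg (sub_neg.2 ht.2)]
  exact mul_le_mul_of_nonneg_left (log_le_sub_one_of_pos ht.1) (rpow_nonneg ht.1.le x)

theorem rpow_mul_log_div_sub_one_le {t : ℝ} (ht : t ∈ Set.Ioc (0 : ℝ) 1) (x : ℝ) :
    t ^ x * log t / (t - 1) ≤ t ^ (x - 1) := by
  rcases ht.2.eq_or_lt with rfl | h1
  · simp
  rw [div_le_iff_of_neg (sub_neg.2 h1), rpow_sub_one ht.1.ne', div_mul_eq_mul_div, mul_div_assoc]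
  refine mul_le_mul_of_nonneg_left ?_ (rpow_nonneg ht.1.le x)
  have h := one_sub_inv_le_log_of_pos ht.1
  rwa [sub_div, div_self ht.1.ne', one_div]

theorem rpow_sub_one_div_sub_one_nonneg {t x : ℝ} (hx : 0 ≤ x) (ht : t ∈ Set.Icc (0 : ℝ) 1) :
    0 ≤ (t ^ x - 1) / (t - 1) :=
  div_nonneg_of_nonpos (sub_nonpos.2 (rpow_le_one ht.1 ht.2 hx)) (sub_nonpos.2 ht.2)

theorem rpow_sub_one_div_sub_one_le {t x : ℝ} (hx : 1 ≤ x) (ht : t ∈ Set.Icc (0 : ℝ) 1) :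
    (t ^ x - 1) / (t - 1) ≤ x := by
  rcases ht.2.eq_or_lt with rfl | h1
  · simpa using zero_le_one.trans hx
  rw [div_le_iff_of_neg (sub_neg.2 h1)]
  have h := one_add_mul_self_le_rpow_one_add (s := t - 1) (by linarith [ht.1]) hx
  rw [add_sub_cancel] at h
  linarith

theorem intervalIntegrable_rpow_sub_one_div_sub_one {x : ℝ} (hx : 1 ≤ x) :
    IntervalIntegrable (fun t : ℝ ↦ (t ^ x - 1) / (t - 1)) MeasureTheory.volume 0 1 := by
  refine (intervalIntegrable_const (c := x)).mono_fun
    (by fun_prop : Measurable _).aestronglyMeasurable ?_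
  refine (MeasureTheory.ae_restrict_iff' measurableSet_uIoc).2 (.of_forall fun t ht ↦ ?_)
  rw [Set.uIoc_of_le zero_le_one] at ht
  have ht' := Set.Ioc_subset_Icc_self ht
  beta_reduce
  rw [norm_of_nonneg (rpow_sub_one_div_sub_one_nonneg (zero_le_one.trans hx) ht'),
    norm_of_nonneg (zero_le_one.trans hx)]
  exact rpow_sub_one_div_sub_one_le hx ht'

theorem hasDerivAt_harmonicInterp {x : ℝ} (hx : 1 < x) :
    IntervalIntegrable (fun t : ℝ ↦ t ^ x * log t / (t - 1)) MeasureTheory.volume 0 1 ∧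
      HasDerivAt harmonicInterp (∫ t in (0 : ℝ)..1, t ^ x * log t / (t - 1)) x := by
  refine intervalIntegral.hasDerivAt_integral_of_dominated_loc_of_deriv_le
    (F := fun x t : ℝ ↦ (t ^ x - 1) / (t - 1)) (F' := fun x t : ℝ ↦ t ^ x * log t / (t - 1))
    (bound := fun _ ↦ 1) (Ioi_mem_nhds hx)
    (.of_forall fun y ↦ (by fun_prop : Measurable _).aestronglyMeasurable)
    (intervalIntegrable_rpow_sub_one_div_sub_one hx.le)
    (by fun_prop : Measurable _).aestronglyMeasurable
    (.of_forall fun t ht y hy ↦ ?_) intervalIntegrable_const (.of_forall fun t ht y _ ↦ ?_)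
  all_goals rw [Set.uIoc_of_le zero_le_one] at ht
  · rw [norm_of_nonneg (rpow_mul_log_div_sub_one_nonneg ht y)]
    exact (rpow_mul_log_div_sub_one_le ht y).trans
      (rpow_le_one ht.1.le ht.2 (sub_nonneg.2 (Set.mem_Ioi.1 hy).le))
  · exact ((hasStrictDerivAt_const_rpow ht.1 y).hasDerivAt.sub_const 1).div_const (t - 1)

theorem inv_add_one_le_deriv_harmonicInterp {x : ℝ} (hx : 1 < x) :
    1 / (x + 1) ≤ deriv harmonicInterp x := by
  obtain ⟨hint, hder⟩ := hasDerivAt_harmonicInterp hx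
  have hpow : ∫ t in (0 : ℝ)..1, t ^ x = 1 / (x + 1) := by
    rw [integral_rpow (.inl (by linarith)), one_rpow, zero_rpow (by linarith), sub_zero]
  rw [hder.deriv, ← hpow]
  exact intervalIntegral.integral_mono_on_of_le_Ioo zero_le_one
    (intervalIntegral.intervalIntegrable_rpow' (by linarith)) hint
    fun t ht ↦ rpow_le_rpow_mul_log_div_sub_one ht x

theorem deriv_harmonicInterp_le_inv {x : ℝ} (hx : 1 < x) :
    deriv harmonicInterp x ≤ 1 / x := by
  obtain ⟨hint, hder⟩ := hasDerivAt_harmonicInterp hx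
  have hpow : ∫ t in (0 : ℝ)..1, t ^ (x - 1) = 1 / x := by
    rw [integral_rpow (.inl (by linarith)), sub_add_cancel, one_rpow, zero_rpow (by linarith),
      sub_zero]
  rw [hder.deriv, ← hpow]
  exact intervalIntegral.integral_mono_on_of_le_Ioo zero_le_one hint
    (intervalIntegral.intervalIntegrable_rpow' (by linarith))
    fun t ht ↦ rpow_mul_log_div_sub_one_le (Set.Ioo_subset_Ioc_self ht) x

theorem harmonicInterp_nonneg {x : ℝ} (hx : 0 ≤ x) : 0 ≤ harmonicInterp x :=
  intervalIntegral.integral_nonneg zero_le_one fun _ ht ↦ rpow_sub_one_div_sub_one_nonneg hx ht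

theorem harmonicInterp_natCast (n : ℕ) : harmonicInterp n = harmonic n := by
  have hgeom : harmonicInterp n = ∫ t in (0 : ℝ)..1, ∑ i ∈ Finset.range n, t ^ i := by
    refine intervalIntegral.integral_congr_Ioo_of_le zero_le_one fun t ht ↦ ?_
    simp only [rpow_natCast, geom_sum_eq ht.2.ne]
  rw [hgeom, intervalIntegral.integral_finsetSum fun i _ ↦ intervalIntegral.intervalIntegrable_pow i]
  simp [harmonic]

theorem harmonicInterp_le_sqrt_add {x : ℝ} (hx : 4 ≤ x) : harmonicInterp x ≤ √x + 1 / 4 := by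
  have hdiff : ∀ y ∈ Set.Ici (4 : ℝ), HasDerivAt (fun y ↦ harmonicInterp y - √y)
      (deriv harmonicInterp y - 1 / (2 * √y)) y := fun y hy ↦ by
    have hy : 4 ≤ y := hy
    exact (hasDerivAt_harmonicInterp (by linarith)).2.differentiableAt.hasDerivAt.sub
      (hasDerivAt_sqrt (by linarith))
  have hanti : AntitoneOn (fun y ↦ harmonicInterp y - √y) (Set.Ici 4) := by
    refine antitoneOn_of_deriv_nonpos (convex_Ici 4)
      (fun y hy ↦ (hdiff y hy).continuousAt.continuousWithinAt)
      (fun y hy ↦ (hdiff y (interior_subset hy)).differentiableAt.differentiableWithinAt)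
      fun y hy ↦ ?_
    have hy' : 4 ≤ y := interior_subset hy
    rw [(hdiff y hy').deriv, sub_nonpos]
    refine (deriv_harmonicInterp_le_inv (by linarith)).trans
      (one_div_le_one_div_of_le (by positivity) ?_)
    have h2 : 2 ≤ √y := le_sqrt_of_sq_le (by linarith)
    nlinarith [sq_sqrt (show 0 ≤ y by linarith)]
  have h := hanti (Set.mem_Ici.2 le_rfl) hx hx
  have h4 : harmonicInterp 4 = 25 / 12 := by
    have := harmonicInterp_natCast 4
    norm_num [harmonic, Finset.sum_range_succ] at this
    exact this
  have hs : √(4 : ℝ) = 2 := by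
    rw [show (4 : ℝ) = 2 ^ 2 by norm_num, sqrt_sq zero_le_two]
  simp only [h4, hs] at h
  linarith

/-- For every real `x ≥ 4`, `H′(x) > H(x)·log(H(x))/x²`. -/
theorem deriv_harmonicInterp_gt (x : ℝ) (hx : 4 ≤ x) :
    deriv harmonicInterp x >
      harmonicInterp x * Real.log (harmonicInterp x) / x ^ 2 := by
  refine lt_of_lt_of_le ?_ (inv_add_one_le_deriv_harmonicInterp (by linarith))
  have hle := harmonicInterp_le_sqrt_add hx
  have hnonneg := harmonicInterp_nonneg (show 0 ≤ x by linarith)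
  generalize harmonicInterp x = H at hle hnonneg ⊢
  have hlog : H * log H ≤ H * (H - 1) := by
    rcases hnonneg.eq_or_lt with rfl | hpos
    · simp
    · exact mul_le_mul_of_nonneg_left (log_le_sub_one_of_pos hpos) hnonneg
  have h2 : 2 ≤ √x := le_sqrt_of_sq_le (by linarith)
  have hsq : √x ^ 2 = x := sq_sqrt (by linarith)
  have hH : H * (H - 1) < x - 1 := by nlinarith
  rw [div_lt_div_iff₀ (by positivity) (by linarith)]
  nlinarith
end
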